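/- arXiv:2412.05678 — 2 statements merged into one kernel-verified Lean document; each statement's English description precedes it below -/
import Mathlib

section
/- Let K be a field of characteristic zero and let v_0, v_1, v_2, v_3, v_4, v_5 be vectors in K^4 with [v_0 v_1 v_2 v_3]·[v_0 v_1 v_4 v_5]·[v_2 v_3 v_4 v_5] ≠ 0 (i.e., the lines 01, 23, 45 are mutually skew). Then there exists a permutation σ of {0,1,2,3,4,5} such that [v_{σ(0)} v_{σ(1)} v_{σ(2)} v_{σ(5)}][v_{σ(0)} v_{σ(2)} v_{σ(3)} v_{σ(4)}][v_{σ(1)} v_{σ(3)} v_{σ(4)} v_{σ(5)}] − [v_{σ(0)} v_{σ(1)} v_{σ(2)} v_{σ(4)}][v_{σ(2)} v_{σ(3)} v_{σ(4)} v_{σ(5)}][v_{σ(0)} v_{σ(1)} v_{σ(3)} v_{σ(5)}] ≠ 0. -/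
/-- The bracket `[a b c d]`: determinant of the 4×4 matrix with columns
(equivalently rows) `a`, `b`, `c`, `d`. -/
def br {K : Type*} [CommRing K] (a b c d : Fin 4 → K) : K :=
  (Matrix.of ![a, b, c, d]).det

/-- Laplace expansion of the bracket along its first two vectors. -/
theorem br_eq_laplace {K : Type*} [CommRing K] (a b c d : Fin 4 → K) :
    br a b c d =
      (a 0 * b 1 - a 1 * b 0) * (c 2 * d 3 - c 3 * d 2) -
      (a 0 * b 2 - a 2 * b 0) * (c 1 * d 3 - c 3 * d 1) +
      (a 0 * b 3 - a 3 * b 0) * (c 1 * d 2 - c 2 * d 1) +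
      (a 1 * b 2 - a 2 * b 1) * (c 0 * d 3 - c 3 * d 0) -
      (a 1 * b 3 - a 3 * b 1) * (c 0 * d 2 - c 2 * d 0) +
      (a 2 * b 3 - a 3 * b 2) * (c 0 * d 1 - c 1 * d 0) := by
  simp only [br, Matrix.det_succ_row_zero, Matrix.of_apply, Fin.sum_univ_succ]
  simp [Fin.succAbove]
  ring

theorem br_swap_right {K : Type*} [CommRing K] (a b c d : Fin 4 → K) :
    br a b d c = -br a b c d := by
  simp only [br_eq_laplace]
  ring

theorem br_swap_middle {K : Type*} [CommRing K] (a b c d : Fin 4 → K) :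
    br a c b d = -br a b c d := by
  simp only [br_eq_laplace]
  ring

/-- The three-term Grassmann–Plücker relation. -/
theorem br_pluecker {K : Type*} [CommRing K] (a b c d e f : Fin 4 → K) :
    br a b c d * br a b e f - br a b c e * br a b d f + br a b c f * br a b d e = 0 := by
  simp only [br_eq_laplace]
  ring

/-- If the lines `01`, `23`, `45` are mutually skew, then some permutation `σ`
of the six point labels makes the bracket binomial `σ(Q)` nonzero. -/
theorem exists_permutation_Q_ne_zero {K : Type*} [Field K] [CharZero K]
    (v : Fin 6 → Fin 4 → K)
    (h : br (v 0) (v 1) (v 2) (v 3) * br (v 0) (v 1) (v 4) (v 5) *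
        br (v 2) (v 3) (v 4) (v 5) ≠ 0) :
    ∃ σ : Equiv.Perm (Fin 6),
      br (v (σ 0)) (v (σ 1)) (v (σ 2)) (v (σ 5)) *
          br (v (σ 0)) (v (σ 2)) (v (σ 3)) (v (σ 4)) *
          br (v (σ 1)) (v (σ 3)) (v (σ 4)) (v (σ 5)) -
        br (v (σ 0)) (v (σ 1)) (v (σ 2)) (v (σ 4)) *
          br (v (σ 2)) (v (σ 3)) (v (σ 4)) (v (σ 5)) *
          br (v (σ 0)) (v (σ 1)) (v (σ 3)) (v (σ 5)) ≠ 0 := by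
  by_contra! hQ
  have h₁ := hQ 1
  have h₂ := hQ (Equiv.swap 4 5)
  have h₃ := hQ (Equiv.swap 3 4)
  have h₄ := hQ (Equiv.swap 4 5 * Equiv.swap 3 4)
  simp only [Equiv.Perm.one_apply] at h₁
  simp [Equiv.swap_apply_def] at h₂ h₃ h₄
  rw [br_swap_right _ _ (v 4) (v 5), br_swap_right _ _ (v 4) (v 5)] at h₂
  rw [br_swap_right _ _ (v 3) (v 4), br_swap_middle _ (v 3) (v 4), br_swap_middle _ (v 3) (v 4)]
    at h₃
  rw [br_swap_right _ _ (v 3) (v 5), br_swap_middle _ (v 3) (v 5), br_swap_middle _ (v 3) (v 5),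
    br_swap_right _ _ (v 4) (v 5), br_swap_right _ _ (v 4) (v 5), br_swap_right _ _ (v 4) (v 5)]
    at h₄
  have hthree : (3 : K) * (br (v 0) (v 1) (v 2) (v 3) * br (v 0) (v 1) (v 4) (v 5) *
      br (v 2) (v 3) (v 4) (v 5)) = 0 := by
    linear_combination -h₁ - h₂ + h₃ + h₄ +
      br (v 2) (v 3) (v 4) (v 5) * br_pluecker (v 0) (v 1) (v 2) (v 3) (v 4) (v 5)
  exact (mul_ne_zero three_ne_zero h) hthree
end

section
/- Let K be a field of characteristic zero, let e_0, e_1, e_2, e_3 be the standard basis of K^4, and set v_0 = e_0, v_1 = e_1, v_2 = e_2, v_3 = e_3 and let v_4, …, v_9 ∈ K^4 be arbitrary, with coordinates v_i = (x_i, y_i, z_i, w_i). Let N be the 10×10 matrix whose i-th row (i = 0, …, 9) is (x_i^2, x_i y_i, x_i z_i, x_i w_i, y_i^2, y_i z_i, y_i w_i, z_i^2, z_i w_i, w_i^2). Let M be the 4×4 matrix whose row indexed by k ∈ {6,7,8,9} is ([v_0 v_1 v_5 v_k][v_2 v_3 v_4 v_k], [v_0 v_1 v_2 v_k][v_3 v_4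 v_5 v_k], [v_0 v_2 v_4 v_k][v_1 v_3 v_5 v_k], [v_0 v_4 v_5 v_k][v_1 v_2 v_3 v_k]), and let Q = −x_5 y_4 z_5 w_4 + x_4 y_5 z_5 w_4 + x_5 y_4 z_4 w_5 − x_4 y_4 z_5 w_5. Then det(M) = Q · det(N). -/
lemma det_fin_four {R : Type*} [CommRing R] (A : Matrix (Fin 4) (Fin 4) R) :
    A.det =
      (A 0 0 * A 1 1 - A 0 1 * A 1 0) * (A 2 2 * A 3 3 - A 2 3 * A 3 2) -
      (A 0 0 * A 1 2 - A 0 2 * A 1 0) * (A 2 1 * A 3 3 - A 2 3 * A 3 1) +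
      (A 0 0 * A 1 3 - A 0 3 * A 1 0) * (A 2 1 * A 3 2 - A 2 2 * A 3 1) +
      (A 0 1 * A 1 2 - A 0 2 * A 1 1) * (A 2 0 * A 3 3 - A 2 3 * A 3 0) -
      (A 0 1 * A 1 3 - A 0 3 * A 1 1) * (A 2 0 * A 3 2 - A 2 2 * A 3 0) +
      (A 0 2 * A 1 3 - A 0 3 * A 1 2) * (A 2 0 * A 3 1 - A 2 1 * A 3 0) := by
  rw [Matrix.det_succ_row_zero]
  simp [Fin.sum_univ_succ, Matrix.det_fin_three, Fin.succAbove]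
  ring

lemma br_eq {R : Type*} [CommRing R] (a b c d : Fin 4 → R) :
    br a b c d =
      (a 0 * b 1 - a 1 * b 0) * (c 2 * d 3 - c 3 * d 2) -
      (a 0 * b 2 - a 2 * b 0) * (c 1 * d 3 - c 3 * d 1) +
      (a 0 * b 3 - a 3 * b 0) * (c 1 * d 2 - c 2 * d 1) +
      (a 1 * b 2 - a 2 * b 1) * (c 0 * d 3 - c 3 * d 0) -
      (a 1 * b 3 - a 3 * b 1) * (c 0 * d 2 - c 2 * d 0) +
      (a 2 * b 3 - a 3 * b 2) * (c 0 * d 1 - c 1 * d 0) := by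
  rw [br, det_fin_four]; simp

lemma det_eq_of_row_zero_eq_single {R : Type*} [CommRing R] {n : ℕ}
    (A : Matrix (Fin (n + 1)) (Fin (n + 1)) R) (j : Fin (n + 1)) (h : A 0 = Pi.single j 1) :
    A.det = (-1) ^ (j : ℕ) * (A.submatrix Fin.succ j.succAbove).det := by
  rw [Matrix.det_succ_row_zero, Finset.sum_eq_single j]
  · simp [h]
  · intro i _ hi
    simp [h, Pi.single_eq_of_ne hi]
  · simp

/-- The values at `p` of the ten quadratic monomials. -/
def veronese {R : Type*} [CommRing R] (p : Fin 4 → R) : Fin 10 → R :=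
  ![p 0 * p 0, p 0 * p 1, p 0 * p 2, p 0 * p 3, p 1 * p 1, p 1 * p 2, p 1 * p 3,
    p 2 * p 2, p 2 * p 3, p 3 * p 3]

/-- The values at `p` of the six squarefree quadratic monomials. -/
def sqfreeVeronese {R : Type*} [CommRing R] (p : Fin 4 → R) : Fin 6 → R :=
  ![p 0 * p 1, p 0 * p 2, p 0 * p 3, p 1 * p 2, p 1 * p 3, p 2 * p 3]

lemma det_veronese_of_basis {R : Type*} [CommRing R] (v : Fin 10 → Fin 4 → R)
    (h0 : v 0 = Pi.single 0 1) (h1 : v 1 = Pi.single 1 1)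
    (h2 : v 2 = Pi.single 2 1) (h3 : v 3 = Pi.single 3 1) :
    (Matrix.of fun i => veronese (v i)).det =
      (Matrix.of fun i : Fin 6 => sqfreeVeronese (v (i.natAdd 4))).det := by
  rw [det_eq_of_row_zero_eq_single _ 0, det_eq_of_row_zero_eq_single _ 3,
    det_eq_of_row_zero_eq_single _ 5, det_eq_of_row_zero_eq_single _ 6]
  · rw [show ((6 : Fin 7) : ℕ) = 6 from rfl, show ((5 : Fin 8) : ℕ) = 5 from rfl,
      show ((3 : Fin 9) : ℕ) = 3 from rfl, show ((0 : Fin 10) : ℕ) = 0 from rfl]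
    norm_num
    congr 1
    ext i j
    fin_cases i <;> fin_cases j <;> rfl
  · ext j
    change veronese (v 3) _ = _
    rw [h3, show veronese (Pi.single 3 1) = (Pi.single 9 1 : Fin 10 → R) by
      ext j; fin_cases j <;> simp [veronese]]
    fin_cases j <;> rfl
  · ext j
    change veronese (v 2) _ = _
    rw [h2, show veronese (Pi.single 2 1) = (Pi.single 7 1 : Fin 10 → R) by
      ext j; fin_cases j <;> simp [veronese]]
    fin_cases j <;> rfl
  · ext j
    change veronese (v 1) _ = _
    rw [h1, show veronese (Pi.single 1 1) = (Pi.single 4 1 : Fin 10 → R) by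
      ext j; fin_cases j <;> simp [veronese]]
    fin_cases j <;> rfl
  · ext j
    change veronese (v 0) _ = _
    rw [h0, show veronese (Pi.single 0 1) = (Pi.single 0 1 : Fin 10 → R) by
      ext j; fin_cases j <;> simp [veronese]]

/-- The four bracket products determined by the basis points and `a`, `b`, as linear forms in
the squarefree quadratic monomials `m`. -/
def quadricRow {R : Type*} [CommRing R] (a b : Fin 4 → R) (m : Fin 6 → R) : Fin 4 → R :=
  ![a 1 * b 3 * m 1 - a 1 * b 2 * m 2 - a 0 * b 3 * m 3 + a 0 * b 2 * m 4,
    -((a 1 * b 2 - a 2 * b 1) * m 2) + (a 0 * b 2 - a 2 * b 0) * m 4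
      - (a 0 * b 1 - a 1 * b 0) * m 5,
    a 3 * b 2 * m 0 - a 1 * b 2 * m 2 - a 3 * b 0 * m 3 + a 1 * b 0 * m 5,
    -((a 2 * b 3 - a 3 * b 2) * m 0) + (a 1 * b 3 - a 3 * b 1) * m 1
      - (a 1 * b 2 - a 2 * b 1) * m 2]

lemma br_products_eq_quadricRow {R : Type*} [CommRing R] (e₀ e₁ e₂ e₃ a b p : Fin 4 → R)
    (h0 : e₀ = Pi.single 0 1) (h1 : e₁ = Pi.single 1 1)
    (h2 : e₂ = Pi.single 2 1) (h3 : e₃ = Pi.single 3 1) :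
    ![br e₀ e₁ b p * br e₂ e₃ a p, br e₀ e₁ e₂ p * br e₃ a b p,
      br e₀ e₂ a p * br e₁ e₃ b p, br e₀ a b p * br e₁ e₂ e₃ p] =
    quadricRow a b (sqfreeVeronese p) := by
  ext j
  fin_cases j <;> simp [br_eq, h0, h1, h2, h3, sqfreeVeronese, quadricRow] <;> ring

set_option maxHeartbeats 4000000 in
-- Both sides expand to several thousand monomials.
lemma det_quadricRow {R : Type*} [CommRing R] (a b : Fin 4 → R) (m : Fin 4 → Fin 6 → R) :
    (Matrix.of fun k => quadricRow a b (m k)).det =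
    (-(b 0 * a 1 * b 2 * a 3) + a 0 * b 1 * b 2 * a 3
        + b 0 * a 1 * a 2 * b 3 - a 0 * a 1 * b 2 * b 3) *
      (Matrix.of ![sqfreeVeronese a, sqfreeVeronese b, m 0, m 1, m 2, m 3]).det := by
  rw [det_fin_four]
  simp [Matrix.det_succ_row_zero, Fin.sum_univ_succ, Fin.succAbove, sqfreeVeronese, quadricRow]
  ring

/-- The identity `det(M) = Q · det(N)` of Section 3.1, with the points
`0`, `1`, `2`, `3` at the standard basis of `K⁴`. -/
theorem det_M_eq_Q_mul_det_N {K : Type*} [Field K] [CharZero K]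
    (v : Fin 10 → Fin 4 → K)
    (h0 : v 0 = Pi.single 0 1) (h1 : v 1 = Pi.single 1 1)
    (h2 : v 2 = Pi.single 2 1) (h3 : v 3 = Pi.single 3 1) :
    (Matrix.of fun k : Fin 4 =>
      ![br (v 0) (v 1) (v 5) (v ⟨(k : ℕ) + 6, by omega⟩) *
          br (v 2) (v 3) (v 4) (v ⟨(k : ℕ) + 6, by omega⟩),
        br (v 0) (v 1) (v 2) (v ⟨(k : ℕ) + 6, by omega⟩) *
          br (v 3) (v 4) (v 5) (v ⟨(k : ℕ) + 6, by omega⟩),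
        br (v 0) (v 2) (v 4) (v ⟨(k : ℕ) + 6, by omega⟩) *
          br (v 1) (v 3) (v 5) (v ⟨(k : ℕ) + 6, by omega⟩),
        br (v 0) (v 4) (v 5) (v ⟨(k : ℕ) + 6, by omega⟩) *
          br (v 1) (v 2) (v 3) (v ⟨(k : ℕ) + 6, by omega⟩)]).det =
    (-(v 5 0 * v 4 1 * v 5 2 * v 4 3) + v 4 0 * v 5 1 * v 5 2 * v 4 3
        + v 5 0 * v 4 1 * v 4 2 * v 5 3 - v 4 0 * v 4 1 * v 5 2 * v 5 3) *
      (Matrix.of fun i : Fin 10 =>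
        ![v i 0 * v i 0, v i 0 * v i 1, v i 0 * v i 2, v i 0 * v i 3,
          v i 1 * v i 1, v i 1 * v i 2, v i 1 * v i 3,
          v i 2 * v i 2, v i 2 * v i 3, v i 3 * v i 3]).det := by
  simp only [br_products_eq_quadricRow _ _ _ _ _ _ _ h0 h1 h2 h3]
  have hN := det_veronese_of_basis v h0 h1 h2 h3
  unfold veronese at hN
  rw [hN, det_quadricRow]
  congr 3
  ext i j
  fin_cases i <;> rfl
end
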